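/- Let P be a finite nonempty subset of a metric space M, let k, ℓ be integers with 1 ≤ ℓ ≤ k ≤ |P|, and let q_1, …, q_m (m ≥ 2) be a Gonzalez sequence in P with r_m = d(q_m, {q_1, …, q_{m-1}}). Let C ⊆ P be any set such that for every i, C contains at least ℓ points of P each within distance dist_ℓ(P, q_i) of q_i (equivalently, dist_ℓ(C, q_i) = dist_ℓ(P, q_i)). Then max_{p ∈ P} dist_ℓ(C, p) ≤ r_m + r_opt, where r_opt is the optimal fault-tolerant k-center cost of P with fault-tolerance parameter ℓ. -/

import Mathlib

/-- `kthDist S p i` is the `i`-th smallest value (1-indexed) among the distances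
`dist p s` for `s ∈ S`, i.e. the radius of the smallest closed ball centered at `p`
containing at least `i` points of `S`. -/
noncomputable def kthDist {M : Type*} [MetricSpace M] (S : Finset M) (p : M) (i : ℕ) : ℝ :=
  ((S.val.map (fun s => dist p s)).sort (· ≤ ·)).getD (i - 1) 0

theorem List.Pairwise.getElem_le_iff_lt_countP {L : List ℝ} (hL : L.Pairwise (· ≤ ·)) {n : ℕ}
    (hn : n < L.length) (r : ℝ) : L[n] ≤ r ↔ n < L.countP (· ≤ r) := by
  constructor
  · intro h
    have htake : (L.take (n + 1)).countP (· ≤ r) = (L.take (n + 1)).length := by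
      rw [List.countP_eq_length]
      intro a ha
      obtain ⟨j, hj, rfl⟩ := List.getElem_of_mem ha
      rw [List.length_take] at hj
      rw [List.getElem_take]
      rcases (by omega : j < n ∨ j = n) with hjn | rfl
      · exact decide_eq_true ((List.pairwise_iff_getElem.1 hL j n _ hn hjn).trans h)
      · exact decide_eq_true h
    have hle := (List.take_sublist (n + 1) L).countP_le (p := (· ≤ r))
    rw [htake, List.length_take] at hle
    omega
  · intro h
    by_contra! hlt
    have hdrop : (L.drop n).countP (· ≤ r) = 0 := by
      rw [List.countP_eq_zero]
      intro a ha
      obtain ⟨j, hj, rfl⟩ := List.getElem_of_mem ha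
      rw [List.length_drop] at hj
      rw [List.getElem_drop]
      suffices r < L[n + j] by simpa using this
      rcases Nat.eq_zero_or_pos j with rfl | hj0
      · simpa using hlt
      · exact hlt.trans_le (List.pairwise_iff_getElem.1 hL n (n + j) hn _ (by omega))
    have hle := (L.take n).countP_le_length (p := (· ≤ r))
    have hsplit : L.countP (· ≤ r) = (L.take n).countP (· ≤ r) + (L.drop n).countP (· ≤ r) := by
      rw [← List.countP_append, List.take_append_drop]
    rw [List.length_take] at hle
    omega

theorem kthDist_le_iff {M : Type*} [MetricSpace M] {S : Finset M} {i : ℕ} (hi : 1 ≤ i)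
    (hiS : i ≤ S.card) (p : M) (r : ℝ) :
    kthDist S p i ≤ r ↔ i ≤ (S.filter (fun x => dist p x ≤ r)).card := by
  have hlen : i - 1 < ((S.val.map (fun s => dist p s)).sort (· ≤ ·)).length := by
    rw [Multiset.length_sort, Multiset.card_map, Finset.card_val]
    omega
  have hcount : ((S.val.map (fun s => dist p s)).sort (· ≤ ·)).countP (· ≤ r) =
      (S.filter (fun x => dist p x ≤ r)).card := by
    rw [← Multiset.coe_countP, Multiset.sort_eq, Multiset.countP_map]
    rfl
  rw [kthDist, List.getD_eq_getElem _ _ hlen,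
    (Multiset.pairwise_sort _ _).getElem_le_iff_lt_countP hlen, hcount]
  omega

theorem kthDist_le_kthDist_of_subset {M : Type*} [MetricSpace M] {S T : Finset M} (hST : S ⊆ T)
    {i : ℕ} (hi : 1 ≤ i) (hiS : i ≤ S.card) (p : M) : kthDist T p i ≤ kthDist S p i := by
  rw [kthDist_le_iff hi (hiS.trans (Finset.card_le_card hST))]
  exact ((kthDist_le_iff hi hiS p _).1 le_rfl).trans
    (Finset.card_le_card (Finset.filter_subset_filter _ hST))

theorem kthDist_le_dist_add {M : Type*} [MetricSpace M] {S : Finset M} {i : ℕ} (hi : 1 ≤ i)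
    (hiS : i ≤ S.card) (p q : M) : kthDist S p i ≤ dist p q + kthDist S q i := by
  rw [kthDist_le_iff hi hiS]
  refine ((kthDist_le_iff hi hiS q _).1 le_rfl).trans (Finset.card_le_card ?_)
  exact Finset.monotone_filter_right S fun x _ hx =>
    (dist_triangle p q x).trans (add_le_add_right hx _)

/-- Let `P` be a finite nonempty subset of a metric space,
`1 ≤ ℓ ≤ k ≤ |P|`, and let `q 1, …, q m` (`m ≥ 2`) be a Gonzalez sequence in `P` with
`r_m = d(q m, {q 1, …, q (m-1)})`.  Let `C ⊆ P` be any set such that for every `i`,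
`C` contains at least `ℓ` points of `P` each within distance `dist_ℓ(P, q i)` of `q i`.
Then `max_{p ∈ P} dist_ℓ(C, p) ≤ r_m + r_opt`, where `r_opt` is the optimal
fault-tolerant `k`-center cost of `P` with fault-tolerance parameter `ℓ`. -/
theorem gonzalez_cost_le_rm_add_ropt {M : Type*} [MetricSpace M] [DecidableEq M]
    (P : Finset M) (hP : P.Nonempty) (k ℓ : ℕ)
    (hl1 : 1 ≤ ℓ) (hlk : ℓ ≤ k) (hkP : k ≤ P.card)
    (ropt : ℝ)
    (hopt : IsLeast {x : ℝ | ∃ C' : Finset M, C' ⊆ P ∧ C'.card = k ∧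
      x = P.sup' hP (fun p => kthDist C' p ℓ)} ropt)
    (m : ℕ) (hm : 2 ≤ m)
    (q : ℕ → M) (hq1 : q 1 ∈ P)
    (hgonz : ∀ i, 2 ≤ i → i ≤ m → q i ∈ P ∧
      ∀ p ∈ P, Metric.infDist p (((Finset.Icc 1 (i - 1)).image q : Finset M) : Set M) ≤
        Metric.infDist (q i) (((Finset.Icc 1 (i - 1)).image q : Finset M) : Set M))
    (C : Finset M) (hCP : C ⊆ P)
    (hC : ∀ i, 1 ≤ i → i ≤ m →
      ℓ ≤ (C.filter (fun x => dist (q i) x ≤ kthDist P (q i) ℓ)).card) :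
    P.sup' hP (fun p => kthDist C p ℓ) ≤
      Metric.infDist (q m) (((Finset.Icc 1 (m - 1)).image q : Finset M) : Set M) + ropt := by
  obtain ⟨⟨C', hC'P, hC'k, rfl⟩, -⟩ := hopt
  have hlC' : ℓ ≤ C'.card := hlk.trans_eq hC'k.symm
  have hlC : ℓ ≤ C.card := (hC m (by omega) le_rfl).trans (Finset.card_filter_le _ _)
  refine Finset.sup'_le _ _ fun p hp => ?_
  have hne : (((Finset.Icc 1 (m - 1)).image q : Finset M) : Set M).Nonempty :=
    ⟨q 1, by simpa using ⟨1, by omega, rfl⟩⟩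
  obtain ⟨y, hy, hpy⟩ := (Finset.finite_toSet ((Finset.Icc 1 (m - 1)).image q)).isCompact
    |>.exists_infDist_eq_dist hne p
  obtain ⟨i, hi, rfl⟩ := Finset.mem_image.1 (Finset.mem_coe.1 hy)
  rw [Finset.mem_Icc] at hi
  have hqi : q i ∈ P := by
    rcases hi.1.eq_or_lt with rfl | h
    · exact hq1
    · exact (hgonz i h (by omega)).1
  calc kthDist C p ℓ ≤ dist p (q i) + kthDist C (q i) ℓ := kthDist_le_dist_add hl1 hlC _ _
    _ ≤ _ := add_le_add (hpy ▸ (hgonz m hm le_rfl).2 p hp) <|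
      calc kthDist C (q i) ℓ ≤ kthDist P (q i) ℓ :=
            (kthDist_le_iff hl1 hlC _ _).2 (hC i hi.1 (by omega))
        _ ≤ kthDist C' (q i) ℓ := kthDist_le_kthDist_of_subset hC'P hl1 hlC' _
        _ ≤ _ := Finset.le_sup' (fun p => kthDist C' p ℓ) hqi
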